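/- Let X be a Polish space and d a complete compatible metric on X such that for all x, y ∈ X and ε, ξ > 0: (i) if the closed ball B̄_d(x,ε) is contained in the open ball B_d(y,ξ), then there exists ρ > 0 with B_d(x, ε+ρ) ⊆ B_d(y, ξ−ρ); and (ii) if B̄_d(x,ε) ∩ B̄_d(y,ξ) = ∅, then there exists ρ > 0 with B_d(x, ε+ρ) ∩ B_d(y, ξ+ρ) = ∅. Then for any pair of presentations P = (X, d, x̄) and S = (X, d, ȳ) one has φ_P(F) ≤ φ_S(F) + 1 for every countable closed F ⊆ X. -/

import Mathlib

open Set Filter Topology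

/-- A presentation `(X, d, x̄)` of a Polish space `X`: a complete metric `d`
compatible with the topology of `X`, together with a dense sequence `x̄`. -/
structure Presentation (X : Type) [TopologicalSpace X] where
  dist : X → X → ℝ
  seq : ℕ → X
  dist_self : ∀ x, dist x x = 0
  eq_of_dist_eq_zero : ∀ x y, dist x y = 0 → x = y
  dist_comm : ∀ x y, dist x y = dist y x
  dist_triangle : ∀ x y z, dist x z ≤ dist x y + dist y z
  /-- `d` is compatible with the topology of `X`. -/
  isOpen_iff : ∀ s : Set X, IsOpen s ↔ ∀ x ∈ s, ∃ ε > 0, ∀ y, dist y x < ε → y ∈ s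
  /-- `d` is complete. -/
  complete : ∀ u : ℕ → X, (∀ ε > 0, ∃ N, ∀ m ≥ N, ∀ n ≥ N, dist (u m) (u n) < ε) →
      ∃ x, ∀ ε > 0, ∃ N, ∀ n ≥ N, dist (u n) x < ε
  /-- the sequence `x̄` is dense. -/
  dense : ∀ x, ∀ ε > 0, ∃ i, dist x (seq i) < ε

namespace Presentation

variable {X : Type} [TopologicalSpace X] (P : Presentation X)

/-- The open ball `B_P(n)`. -/
def ball (n : ℕ × ℕ) : Set X := {x | P.dist x (P.seq n.1) < (1/2 : ℝ) ^ (n.2 + 1)}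

/-- The closed ball `B̄_P(n)`. -/
def cball (n : ℕ × ℕ) : Set X := {x | P.dist x (P.seq n.1) ≤ (1/2 : ℝ) ^ (n.2 + 1)}

/-- The relation `n ≺_P m`. -/
def prec (n m : ℕ × ℕ) : Prop := n.2 < m.2 ∧ P.cball m ⊆ P.ball n

/-- The relation `n ⋏_P m`. -/
def apart (n m : ℕ × ℕ) : Prop := P.cball n ∩ P.cball m = ∅

/-- The code `A_F^P` of a closed set `F ⊆ X`. -/
def code (F : Set X) : Set (ℕ × ℕ) := {n | (P.ball n ∩ F).Nonempty}

/-- The derivative `D_P` on subsets of `ω × ω`. -/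
def deriv (A : Set (ℕ × ℕ)) : Set (ℕ × ℕ) :=
  {n ∈ A | ∃ u ∈ A, ∃ v ∈ A, P.prec n u ∧ P.prec n v ∧ P.apart u v}

/-- The transfinite iterates `D_P^α(A)`. -/
noncomputable def derivIter (A : Set (ℕ × ℕ)) (α : Ordinal.{0}) : Set (ℕ × ℕ) :=
  Ordinal.limitRecOn α A (fun _ ih => P.deriv ih)
    (fun o _ ih => ⋂ (β : {β : Ordinal.{0} // β < o}), ih β.1 β.2)

/-- The rank `|A|_P`: the least ordinal `α` with `D_P^α(A) = D_P^{α+1}(A)`. -/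
noncomputable def rankA (A : Set (ℕ × ℕ)) : Ordinal.{0} :=
  sInf {α | P.derivIter A (α + 1) = P.derivIter A α}

/-- The rank `φ_P(F) = |A_F^P|_P` of a (countable closed) subset `F ⊆ X`. -/
noncomputable def phi (F : Set X) : Ordinal.{0} := P.rankA (P.code F)

/-- `A ⊆ ω × ω` is `P`-closed. -/
def PClosed (A : Set (ℕ × ℕ)) : Prop := ∀ n ∈ A, ∀ m, P.prec m n → m ∈ A

/-- `A ⊆ ω × ω` is `P`-pruned. -/
def PPruned (A : Set (ℕ × ℕ)) : Prop := ∀ n ∈ A, ∃ m ∈ A, P.prec n m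

/-- `A ⊆ ω × ω` is `P`-perfect. -/
def PPerfect (A : Set (ℕ × ℕ)) : Prop :=
  ∀ n ∈ A, ∃ u ∈ A, ∃ v ∈ A, P.prec n u ∧ P.prec n v ∧ P.apart u v

/-- The set `[A]_P` of `P`-compatible sequences lying in `A`. -/
def body (A : Set (ℕ × ℕ)) : Set (ℕ → ℕ × ℕ) :=
  {f | (∀ i, P.prec (f i) (f (i + 1))) ∧ ∀ i, f i ∈ A}

/-- The set `F_A^P = π_P([A]_P)`: the points obtained as the unique point of
`⋂_i B_P(n_i)` for a `P`-compatible sequence `(n_i)` in `A`. -/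
def limitSet (A : Set (ℕ × ℕ)) : Set X :=
  {x | ∃ f ∈ P.body A, ∀ i, x ∈ P.ball (f i)}

end Presentation

section CB

variable {X : Type} [TopologicalSpace X]

/-- The Cantor–Bendixson derivative: the set of limit points of `F` in `F`. -/
def cbDeriv (F : Set X) : Set X := {x ∈ F | AccPt x (𝓟 F)}

/-- The iterated Cantor–Bendixson derivatives `F^α`. -/
noncomputable def cbIter (F : Set X) (α : Ordinal.{0}) : Set X :=
  Ordinal.limitRecOn α F (fun _ ih => cbDeriv ih)
    (fun o _ ih => ⋂ (β : {β : Ordinal.{0} // β < o}), ih β.1 β.2)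

/-- The Cantor–Bendixson rank `|F|_CB`. -/
noncomputable def cbRank (F : Set X) : Ordinal.{0} :=
  sInf {α | cbIter F (α + 1) = cbIter F α}

/-- The `K_σ`-derivative of a subset `A ⊆ X`: the points of `A` having no open
neighborhood in the subspace `A` whose closure in `A` is compact. -/
def kDeriv (A : Set X) : Set X :=
  {x ∈ A | ∀ U : Set X, IsOpen U → x ∈ U → ¬ IsCompact (A ∩ closure (U ∩ A))}

/-- The iterated `K_σ`-derivatives `X_α` of the space `X`. -/
noncomputable def kIter (X : Type) [TopologicalSpace X] (α : Ordinal.{0}) : Set X :=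
  Ordinal.limitRecOn α Set.univ (fun _ ih => kDeriv ih)
    (fun o _ ih => ⋂ (β : {β : Ordinal.{0} // β < o}), ih β.1 β.2)

/-- The `K_σ`-rank `|X|_{K_σ}`. -/
noncomputable def kRank (X : Type) [TopologicalSpace X] : Ordinal.{0} :=
  sInf {α | kIter X (α + 1) = kIter X α}

end CB

namespace Presentation

variable {X : Type} [TopologicalSpace X]

theorem derivIter_zero (P : Presentation X) (A : Set (ℕ × ℕ)) : P.derivIter A 0 = A :=
  Ordinal.limitRecOn_zero _ _ _

theorem derivIter_add_one (P : Presentation X) (A : Set (ℕ × ℕ)) (α : Ordinal.{0}) :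
    P.derivIter A (α + 1) = P.deriv (P.derivIter A α) :=
  Ordinal.limitRecOn_add_one _ _ _ _

theorem mem_derivIter_limit (P : Presentation X) (A : Set (ℕ × ℕ)) {o : Ordinal.{0}}
    (ho : Order.IsSuccLimit o) (n : ℕ × ℕ) :
    n ∈ P.derivIter A o ↔ ∀ β < o, n ∈ P.derivIter A β := by
  have h : P.derivIter A o = ⋂ β : {β : Ordinal.{0} // β < o}, P.derivIter A β.1 :=
    Ordinal.limitRecOn_limit _ _ _ _ ho
  rw [h]
  simp

theorem derivIter_antitone (P : Presentation X) (A : Set (ℕ × ℕ)) :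
    Antitone (P.derivIter A) := by
  intro α β hαβ
  induction β using Ordinal.limitRecOn with
  | zero =>
    obtain rfl : α = 0 := le_antisymm hαβ zero_le
    exact le_rfl
  | add_one β ih =>
    rcases hαβ.lt_or_eq with h | rfl
    · rw [derivIter_add_one]
      exact (Set.sep_subset _ _).trans (ih (Order.lt_add_one_iff.mp h))
    · exact le_rfl
  | limit β hβ _ =>
    rcases hαβ.lt_or_eq with h | rfl
    · exact fun n hn => (P.mem_derivIter_limit A hβ n).mp hn α h
    · exact le_rfl

theorem derivIter_rankA (P : Presentation X) (A : Set (ℕ × ℕ)) :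
    P.derivIter A (P.rankA A + 1) = P.derivIter A (P.rankA A) := by
  have hne : {α | P.derivIter A (α + 1) = P.derivIter A α}.Nonempty := by
    by_contra hempty
    refine not_injective_of_ordinal (P.derivIter A) (StrictAnti.injective fun α β hαβ => ?_)
    refine (P.derivIter_antitone A (Order.add_one_le_iff.mpr hαβ)).trans_lt
      (lt_of_le_of_ne (P.derivIter_antitone A (Order.le_succ α)) fun h => hempty ⟨α, h⟩)
  exact csInf_mem hne

theorem pPerfect_derivIter_rankA (P : Presentation X) (A : Set (ℕ × ℕ)) :
    P.PPerfect (P.derivIter A (P.rankA A)) := by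
  intro n hn
  rw [← derivIter_rankA, derivIter_add_one] at hn
  exact hn.2

theorem rankA_le_of_derivIter_eq_empty (P : Presentation X) (A : Set (ℕ × ℕ)) {α : Ordinal.{0}}
    (h : P.derivIter A α = ∅) : P.rankA A ≤ α := by
  refine csInf_le' ?_
  rw [Set.mem_ofPred_eq, derivIter_add_one, h]
  exact Set.eq_empty_of_subset_empty (Set.sep_subset _ _)

theorem ball_subset_cball (P : Presentation X) (n : ℕ × ℕ) : P.ball n ⊆ P.cball n := by
  intro x hx
  exact le_of_lt (show P.dist x _ < _ from hx)

theorem exists_mem_forall_cball (P : Presentation X) {F : Set X} (hF : IsClosed F)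
    {f : ℕ → ℕ × ℕ} (hf : f ∈ P.body (P.code F)) : ∃ x ∈ F, ∀ k, x ∈ P.cball (f k) := by
  obtain ⟨hprec, hcode⟩ := hf
  choose p hpb hpF using hcode
  have hanti : Antitone fun k => P.ball (f k) := antitone_nat_of_succ_le fun k =>
    (P.ball_subset_cball _).trans (hprec k).2
  have hlevel (k : ℕ) : k ≤ (f k).2 := (strictMono_nat_of_lt_succ fun k => (hprec k).1).le_apply
  have hball : ∀ {k m}, k ≤ m → p m ∈ P.ball (f k) := fun h => hanti h (hpb _)
  have hcauchy : ∀ ε > 0, ∃ N, ∀ m ≥ N, ∀ n ≥ N, P.dist (p m) (p n) < ε := by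
    intro ε hε
    obtain ⟨N, hN⟩ := exists_pow_lt_of_lt_one hε (by norm_num : (1 / 2 : ℝ) < 1)
    refine ⟨N, fun m hm n hn => ?_⟩
    have hm' : P.dist (p m) _ < _ := hball hm
    have hn' : P.dist (p n) _ < _ := hball hn
    have htri := P.dist_triangle (p m) (P.seq (f N).1) (p n)
    have hle : (1 / 2 : ℝ) ^ (f N).2 ≤ (1 / 2) ^ N :=
      pow_le_pow_of_le_one (by norm_num) (by norm_num) (hlevel N)
    rw [P.dist_comm (P.seq _)] at htri
    rw [pow_succ] at hm' hn'
    linarith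
  obtain ⟨x, hx⟩ := P.complete p hcauchy
  refine ⟨x, ?_, fun k => ?_⟩
  · by_contra hxF
    obtain ⟨ε, hε, h⟩ := (P.isOpen_iff Fᶜ).mp hF.isOpen_compl x hxF
    obtain ⟨N, hN⟩ := hx ε hε
    exact h _ (hN N le_rfl) (hpF N)
  · change P.dist x (P.seq (f k).1) ≤ (1 / 2) ^ ((f k).2 + 1)
    refine le_of_forall_pos_le_add fun ε hε => ?_
    obtain ⟨N, hN⟩ := hx ε hε
    have hlim := hN (max N k) (le_max_left _ _)
    have hk : P.dist (p (max N k)) _ < _ := hball (le_max_right N k)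
    have htri := P.dist_triangle x (p (max N k)) (P.seq (f k).1)
    rw [P.dist_comm x (p _)] at htri
    linarith

theorem PPerfect.eq_empty_of_subset_code {P : Presentation X} {F : Set X} {B : Set (ℕ × ℕ)}
    (hB : P.PPerfect B) (hF : IsClosed F) (hcnt : F.Countable) (hsub : B ⊆ P.code F) :
    B = ∅ := by
  by_contra hne
  obtain ⟨n₀, hn₀⟩ := Set.nonempty_iff_ne_empty.mpr hne
  choose L hL R hR hnL hnR hLR using hB
  let node (s : ℕ → Bool) (k : ℕ) : B := Nat.rec (motive := fun _ => B) ⟨n₀, hn₀⟩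
    (fun i n => bif s i then ⟨L n n.2, hL n n.2⟩ else ⟨R n n.2, hR n n.2⟩) k
  have node_succ (s : ℕ → Bool) (k : ℕ) : node s (k + 1) =
    bif s k then ⟨L _ (node s k).2, hL _ _⟩ else ⟨R _ (node s k).2, hR _ _⟩ := rfl
  have hbody (s : ℕ → Bool) : (fun k => (node s k).1) ∈ P.body (P.code F) := by
    refine ⟨fun k => ?_, fun k => hsub (node s k).2⟩
    simp only [node_succ]
    cases s k
    · exact hnR _ _
    · exact hnL _ _
  choose x hxF hx using fun s => P.exists_mem_forall_cball hF (hbody s)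
  have hinj : Function.Injective fun s => (⟨x s, hxF s⟩ : F) := by
    intro s t hst
    have hxst : x s = x t := congrArg Subtype.val hst
    have hnode (k : ℕ) : node s k = node t k → s k = t k := by
      intro hk
      have hs := hx s (k + 1)
      have ht := hx t (k + 1)
      rw [node_succ] at hs ht
      rw [hxst, hk] at hs
      have hdisj : x t ∉ P.cball (L _ (node t k).2) ∩ P.cball (R _ (node t k).2) := by
        rw [show _ = (∅ : Set X) from hLR _ (node t k).2]
        exact Set.notMem_empty _
      cases hsk : s k <;> cases htk : t k
      · rfl
      · rw [hsk] at hs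
        rw [htk] at ht
        exact (hdisj ⟨ht, hs⟩).elim
      · rw [hsk] at hs
        rw [htk] at ht
        exact (hdisj ⟨hs, ht⟩).elim
      · rfl
    have heq (k : ℕ) : node s k = node t k := by
      induction k with
      | zero => rfl
      | succ k ih => rw [node_succ, node_succ, hnode k ih, ih]
    exact funext fun k => hnode k (heq k)
  have : Countable F := hcnt
  have : Uncountable (ℕ → Bool) := by
    rw [← Cardinal.aleph0_lt_mk_iff]
    simpa using Cardinal.cantor Cardinal.aleph0
  exact not_countable (α := ℕ → Bool) hinj.countable

theorem derivIter_rankA_code_eq_empty (P : Presentation X) {F : Set X} (hF : IsClosed F)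
    (hcnt : F.Countable) : P.derivIter (P.code F) (P.rankA (P.code F)) = ∅ := by
  refine (P.pPerfect_derivIter_rankA _).eq_empty_of_subset_code hF hcnt ?_
  simpa only [derivIter_zero] using P.derivIter_antitone (P.code F) (zero_le (a := P.rankA (P.code F)))

section Transfer

variable {P S : Presentation X}

theorem exists_radius_code (hPS : S.dist = P.dist) {F : Set X} {n : ℕ × ℕ} (hn : n ∈ P.code F) :
    ∃ ρ > 0, ∀ i, P.dist (P.seq n.1) (S.seq i) < ρ → (i, n.2) ∈ S.code F := by
  obtain ⟨x, hxn, hxF⟩ := hn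
  refine ⟨(1 / 2) ^ (n.2 + 1) - P.dist x (P.seq n.1), sub_pos.mpr hxn, fun i hi => ⟨x, ?_, hxF⟩⟩
  have htri := P.dist_triangle x (P.seq n.1) (S.seq i)
  change S.dist x (S.seq i) < (1 / 2) ^ (n.2 + 1)
  rw [hPS]
  linarith

theorem exists_radius_prec (hPS : S.dist = P.dist)
    (h1 : ∀ (x y : X) (ε ξ : ℝ), 0 < ε → 0 < ξ →
      {z | P.dist z x ≤ ε} ⊆ {z | P.dist z y < ξ} →
      ∃ ρ > 0, {z | P.dist z x < ε + ρ} ⊆ {z | P.dist z y < ξ - ρ})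
    {n u : ℕ × ℕ} (h : P.prec n u) :
    ∃ ρ > 0, ∀ i j, P.dist (P.seq n.1) (S.seq i) < ρ → P.dist (P.seq u.1) (S.seq j) < ρ →
      S.prec (i, n.2) (j, u.2) := by
  obtain ⟨ρ, hρ, hsub⟩ := h1 _ _ _ _ (by positivity) (by positivity) h.2
  refine ⟨ρ, hρ, fun i j hi hj => ⟨h.1, fun z hz => ?_⟩⟩
  change S.dist z (S.seq j) ≤ (1 / 2) ^ (u.2 + 1) at hz
  change S.dist z (S.seq i) < (1 / 2) ^ (n.2 + 1)
  rw [hPS] at hz ⊢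
  rw [P.dist_comm] at hj
  have hzu := P.dist_triangle z (S.seq j) (P.seq u.1)
  have hzn : P.dist z (P.seq n.1) < (1 / 2) ^ (n.2 + 1) - ρ :=
    hsub (show P.dist z (P.seq u.1) < (1 / 2) ^ (u.2 + 1) + ρ by linarith)
  have htri := P.dist_triangle z (P.seq n.1) (S.seq i)
  linarith

theorem exists_radius_apart (hPS : S.dist = P.dist)
    (h2 : ∀ (x y : X) (ε ξ : ℝ), 0 < ε → 0 < ξ →
      {z | P.dist z x ≤ ε} ∩ {z | P.dist z y ≤ ξ} = ∅ →
      ∃ ρ > 0, {z | P.dist z x < ε + ρ} ∩ {z | P.dist z y < ξ + ρ} = ∅)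
    {u v : ℕ × ℕ} (h : P.apart u v) :
    ∃ ρ > 0, ∀ i j, P.dist (P.seq u.1) (S.seq i) < ρ → P.dist (P.seq v.1) (S.seq j) < ρ →
      S.apart (i, u.2) (j, v.2) := by
  obtain ⟨ρ, hρ, hdisj⟩ := h2 _ _ _ _ (by positivity) (by positivity) h
  refine ⟨ρ, hρ, fun i j hi hj => Set.eq_empty_iff_forall_notMem.mpr fun z ⟨hzi, hzj⟩ => ?_⟩
  change S.dist z (S.seq i) ≤ (1 / 2) ^ (u.2 + 1) at hzi
  change S.dist z (S.seq j) ≤ (1 / 2) ^ (v.2 + 1) at hzj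
  rw [hPS] at hzi hzj
  rw [P.dist_comm] at hi hj
  have hzu := P.dist_triangle z (S.seq i) (P.seq u.1)
  have hzv := P.dist_triangle z (S.seq j) (P.seq v.1)
  exact Set.eq_empty_iff_forall_notMem.mp hdisj z
    ⟨show P.dist z (P.seq u.1) < (1 / 2) ^ (u.2 + 1) + ρ by linarith,
      show P.dist z (P.seq v.1) < (1 / 2) ^ (v.2 + 1) + ρ by linarith⟩

/-- If `n` lies in `D_P(A)` then every `S`-ball of the same radius whose centre is close enough
to that of `n` lies in `D_S(B)`, with a bound on the distance that depends on `A` only: `B` merely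
has to contain arbitrarily good approximations of the elements of `A`. -/
theorem exists_radius_deriv (hPS : S.dist = P.dist)
    (h1 : ∀ (x y : X) (ε ξ : ℝ), 0 < ε → 0 < ξ →
      {z | P.dist z x ≤ ε} ⊆ {z | P.dist z y < ξ} →
      ∃ ρ > 0, {z | P.dist z x < ε + ρ} ⊆ {z | P.dist z y < ξ - ρ})
    (h2 : ∀ (x y : X) (ε ξ : ℝ), 0 < ε → 0 < ξ →
      {z | P.dist z x ≤ ε} ∩ {z | P.dist z y ≤ ξ} = ∅ →
      ∃ ρ > 0, {z | P.dist z x < ε + ρ} ∩ {z | P.dist z y < ξ + ρ} = ∅)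
    {A : Set (ℕ × ℕ)} {n : ℕ × ℕ} (hn : n ∈ P.deriv A) :
    ∃ ρ > 0, ∀ i, P.dist (P.seq n.1) (S.seq i) < ρ → ∀ B : Set (ℕ × ℕ), (i, n.2) ∈ B →
      (∀ u ∈ A, ∃ δ > 0, ∀ j, P.dist (P.seq u.1) (S.seq j) < δ → (j, u.2) ∈ B) →
      (i, n.2) ∈ S.deriv B := by
  obtain ⟨-, u, hu, v, hv, hnu, hnv, huv⟩ := hn
  obtain ⟨ρ₁, hρ₁, h₁⟩ := exists_radius_prec hPS h1 hnu
  obtain ⟨ρ₂, hρ₂, h₂⟩ := exists_radius_prec hPS h1 hnv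
  obtain ⟨ρ₃, hρ₃, h₃⟩ := exists_radius_apart hPS h2 huv
  refine ⟨min ρ₁ ρ₂, lt_min hρ₁ hρ₂, fun i hi B hiB hB => ⟨hiB, ?_⟩⟩
  obtain ⟨δ, hδ, hδB⟩ := hB u hu
  obtain ⟨η, hη, hηB⟩ := hB v hv
  obtain ⟨j, hj⟩ := S.dense (P.seq u.1) (min δ (min ρ₁ ρ₃)) (lt_min hδ (lt_min hρ₁ hρ₃))
  obtain ⟨k, hk⟩ := S.dense (P.seq v.1) (min η (min ρ₂ ρ₃)) (lt_min hη (lt_min hρ₂ hρ₃))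
  rw [hPS] at hj hk
  simp only [lt_min_iff] at hi hj hk
  exact ⟨(j, u.2), hδB j hj.1, (k, v.2), hηB k hk.1, h₁ i j hi.1 hj.2.1, h₂ i k hi.2 hk.2.1,
    h₃ j k hj.2.2 hk.2.2⟩

theorem exists_radius_derivIter (hPS : S.dist = P.dist)
    (h1 : ∀ (x y : X) (ε ξ : ℝ), 0 < ε → 0 < ξ →
      {z | P.dist z x ≤ ε} ⊆ {z | P.dist z y < ξ} →
      ∃ ρ > 0, {z | P.dist z x < ε + ρ} ⊆ {z | P.dist z y < ξ - ρ})
    (h2 : ∀ (x y : X) (ε ξ : ℝ), 0 < ε → 0 < ξ →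
      {z | P.dist z x ≤ ε} ∩ {z | P.dist z y ≤ ξ} = ∅ →
      ∃ ρ > 0, {z | P.dist z x < ε + ρ} ∩ {z | P.dist z y < ξ + ρ} = ∅)
    (F : Set X) (α : Ordinal.{0}) :
    ∀ n ∈ P.derivIter (P.code F) (α + 1), ∃ ρ > 0, ∀ i, P.dist (P.seq n.1) (S.seq i) < ρ →
      (i, n.2) ∈ S.derivIter (S.code F) α := by
  have hanti := P.derivIter_antitone (P.code F)
  induction α using Ordinal.limitRecOn with
  | zero =>
    intro n hn
    have hn' := hanti zero_le hn
    rw [derivIter_zero] at hn' ⊢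
    exact exists_radius_code hPS hn'
  | add_one α ih =>
    intro n hn
    obtain ⟨δ, hδ, hδα⟩ := ih n (hanti (Order.le_succ _) hn)
    rw [P.derivIter_add_one] at hn
    obtain ⟨ρ, hρ, h⟩ := exists_radius_deriv hPS h1 h2 hn
    refine ⟨min δ ρ, lt_min hδ hρ, fun i hi => ?_⟩
    rw [lt_min_iff] at hi
    rw [S.derivIter_add_one]
    exact h i hi.2 _ (hδα i hi.1) ih
  | limit α hα ih =>
    intro n hn
    have hn₀ := hanti zero_le hn
    rw [derivIter_zero] at hn₀
    obtain ⟨δ, hδ, hδ₀⟩ := exists_radius_code hPS hn₀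
    rw [P.derivIter_add_one] at hn
    obtain ⟨ρ, hρ, h⟩ := exists_radius_deriv hPS h1 h2 hn
    refine ⟨min δ ρ, lt_min hδ hρ, fun i hi => ?_⟩
    rw [lt_min_iff] at hi
    have hmem (β : Ordinal.{0}) : β < α → (i, n.2) ∈ S.derivIter (S.code F) β := by
      induction β using Ordinal.limitRecOn with
      | zero =>
        intro _
        rw [derivIter_zero]
        exact hδ₀ i hi.1
      | add_one β ihβ =>
        intro hβ
        have hβα : β < α := (Order.lt_succ β).trans hβ
        rw [S.derivIter_add_one]
        exact h i hi.2 _ (ihβ hβα) fun u hu => ih β hβα u (hanti hβ.le hu)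
      | limit β hβ ihβ =>
        exact fun hβα => (S.mem_derivIter_limit _ hβ _).mpr fun γ hγ => ihβ γ hγ (hγ.trans hβα)
    exact (S.mem_derivIter_limit _ hα _).mpr hmem

end Transfer

end Presentation

/-- Under the two ball-separation conditions on `d`, any two presentations
with metric `d` satisfy `φ_P(F) ≤ φ_S(F) + 1` on countable closed sets. -/
theorem stmt11 {X : Type} [TopologicalSpace X] [PolishSpace X]
    (P S : Presentation X) (hPS : S.dist = P.dist)
    (h1 : ∀ (x y : X) (ε ξ : ℝ), 0 < ε → 0 < ξ →
      {z | P.dist z x ≤ ε} ⊆ {z | P.dist z y < ξ} →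
      ∃ ρ > 0, {z | P.dist z x < ε + ρ} ⊆ {z | P.dist z y < ξ - ρ})
    (h2 : ∀ (x y : X) (ε ξ : ℝ), 0 < ε → 0 < ξ →
      {z | P.dist z x ≤ ε} ∩ {z | P.dist z y ≤ ξ} = ∅ →
      ∃ ρ > 0, {z | P.dist z x < ε + ρ} ∩ {z | P.dist z y < ξ + ρ} = ∅)
    (F : Set X) (hF : IsClosed F) (hcnt : F.Countable) :
    P.phi F ≤ S.phi F + 1 := by
  refine P.rankA_le_of_derivIter_eq_empty _ (Set.eq_empty_iff_forall_notMem.mpr fun n hn => ?_)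
  obtain ⟨ρ, hρ, h⟩ := Presentation.exists_radius_derivIter hPS h1 h2 F _ n hn
  obtain ⟨i, hi⟩ := S.dense (P.seq n.1) ρ hρ
  rw [hPS] at hi
  have hmem := h i hi
  rw [Presentation.phi, S.derivIter_rankA_code_eq_empty hF hcnt] at hmem
  exact hmem
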